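/- arXiv:math/0611842 — 3 statements merged into one kernel-verified Lean document; each statement's English description precedes it below -/
import Mathlib

section
/- Let G belong to F(d,m), let M be a maximum matching of G, and suppose G has at least one isolated vertex. Then every vertex v of G that is not a star vertex relative to M has degree exactly d-1. -/
open SimpleGraph

/-- `M` is a matching of `G`: a set of edges of `G` that are pairwise vertex-disjoint. -/
def IsMatchingSet {V : Type} (G : SimpleGraph V) (M : Set (Sym2 V)) : Prop :=
  M ⊆ G.edgeSet ∧ M.Pairwise fun e f => ∀ v : V, v ∈ e → v ∉ f

/-- The matching number `ν(G)`: the maximum size of a matching in `G`. -/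
noncomputable def nu {V : Type} (G : SimpleGraph V) : ℕ :=
  sSup {n | ∃ M : Set (Sym2 V), IsMatchingSet G M ∧ M.ncard = n}

/-- `v` is saturated (covered) by the matching `M`. -/
def MSaturates {V : Type} (M : Set (Sym2 V)) (v : V) : Prop := ∃ e ∈ M, v ∈ e

/-- The edges of the walk `p` alternate: the `i`-th edge belongs to `M` iff `i` is odd
(so the walk starts with a non-matching edge). -/
def IsAlternating {V : Type} (M : Set (Sym2 V)) {G : SimpleGraph V} {a b : V}
    (p : G.Walk a b) : Prop :=
  ∀ (i : ℕ) (h : i < p.edges.length), (p.edges[i]'h ∈ M ↔ Odd i)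

/-- A star path of `G` relative to `M`: a path of even length, alternating starting with a
non-matching edge, whose initial vertex is `M`-unsaturated. -/
def IsStarPath {V : Type} (M : Set (Sym2 V)) {G : SimpleGraph V} {a b : V}
    (p : G.Walk a b) : Prop :=
  p.IsPath ∧ Even p.length ∧ ¬ MSaturates M a ∧ IsAlternating M p

/-- `v` is a star vertex of `G` relative to `M`: some star path terminates at `v`. -/
def IsStarVertex {V : Type} (G : SimpleGraph V) (M : Set (Sym2 V)) (v : V) : Prop :=
  ∃ a : V, ∃ p : G.Walk a v, IsStarPath M p

/-- An `M`-augmenting path: a path of odd length, alternating starting and ending with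
non-matching edges, both of whose endpoints are `M`-unsaturated. -/
def IsAugPath {V : Type} (M : Set (Sym2 V)) {G : SimpleGraph V} {a b : V}
    (p : G.Walk a b) : Prop :=
  p.IsPath ∧ Odd p.length ∧ ¬ MSaturates M a ∧ ¬ MSaturates M b ∧ IsAlternating M p

/-- `G ∈ F(d,m)`: `G` is a finite simple graph with maximum degree `< d` and matching
number `< m`, edge-maximal with this property among all finite graphs on vertex sets
containing `V(G)`. -/
def MemF (d m : ℕ) {V : Type} [Fintype V] (G : SimpleGraph V) : Prop :=
  (∀ v : V, (G.neighborSet v).ncard < d) ∧ nu G < m ∧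
  ∀ (W : Type) [Fintype W] (f : V ↪ W) (G' : SimpleGraph W),
    (∀ u v : V, G.Adj u v → G'.Adj (f u) (f v)) →
    G.edgeSet.ncard < G'.edgeSet.ncard →
    (∃ w : W, d ≤ (G'.neighborSet w).ncard) ∨ m ≤ nu G'

section Matchings

variable {V : Type} {G : SimpleGraph V} {M N : Set (Sym2 V)}

theorem IsMatchingSet.eq_of_mem (hM : IsMatchingSet G M) {e f : Sym2 V} {v : V} (he : e ∈ M)
    (hf : f ∈ M) (hve : v ∈ e) (hvf : v ∈ f) : e = f := by
  by_contra h
  exact hM.2 he hf h v hve hvf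

theorem IsMatchingSet.subset (hM : IsMatchingSet G M) (h : N ⊆ M) : IsMatchingSet G N :=
  ⟨h.trans hM.1, hM.2.mono h⟩

theorem IsMatchingSet.insert (hM : IsMatchingSet G M) {e : Sym2 V} (he : e ∈ G.edgeSet)
    (h : ∀ v ∈ e, ¬ MSaturates M v) : IsMatchingSet G (insert e M) := by
  refine ⟨Set.insert_subset he hM.1, ?_⟩
  rintro f (rfl | hf) g (rfl | hg) hne w hwf hwg
  · exact hne rfl
  · exact h w hwf ⟨g, hg, hwg⟩
  · exact h w hwg ⟨f, hf, hwf⟩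
  · exact hM.2 hf hg hne w hwf hwg

theorem bddAbove_ncard_matching [Finite V] (G : SimpleGraph V) :
    BddAbove {n | ∃ M : Set (Sym2 V), IsMatchingSet G M ∧ M.ncard = n} := by
  refine ⟨G.edgeSet.ncard, ?_⟩
  rintro _ ⟨M, hM, rfl⟩
  exact Set.ncard_le_ncard hM.1 (Set.toFinite _)

theorem IsMatchingSet.ncard_le_nu [Finite V] (hM : IsMatchingSet G M) : M.ncard ≤ nu G :=
  le_csSup (bddAbove_ncard_matching G) ⟨M, hM, rfl⟩

theorem exists_isMatchingSet_ncard_eq_nu [Finite V] (G : SimpleGraph V) :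
    ∃ M : Set (Sym2 V), IsMatchingSet G M ∧ M.ncard = nu G :=
  Nat.sSup_mem (s := {n | ∃ M : Set (Sym2 V), IsMatchingSet G M ∧ M.ncard = n})
    ⟨0, ∅, ⟨Set.empty_subset _, Set.pairwise_empty _⟩, Set.ncard_empty _⟩
    (bddAbove_ncard_matching G)

theorem IsAlternating.concat {a b c : V} {p : G.Walk a b} (hp : IsAlternating M p)
    (h : G.Adj b c) (hbc : s(b, c) ∈ M ↔ Odd p.length) : IsAlternating M (p.concat h) := by
  intro i hi
  simp only [Walk.edges_concat, List.concat_eq_append, List.length_append, List.length_singleton,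
    Walk.length_edges] at hi ⊢
  rcases Nat.lt_succ_iff_lt_or_eq.mp hi with hlt | rfl
  · rw [List.getElem_append_left (by simpa using hlt)]
    exact hp i (by simpa using hlt)
  · rw [List.getElem_append_right (by simp)]
    simpa using hbc

/-- A star path can be extended by a non-matching edge followed by a matching edge. -/
theorem IsStarPath.concat_concat {a b c v : V} {p : G.Walk a b} (hp : IsStarPath M p)
    (hbc : G.Adj b c) (hcv : G.Adj c v) (hbcM : s(b, c) ∉ M) (hcvM : s(c, v) ∈ M)
    (hc : c ∉ p.support) (hv : v ∉ p.support) :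
    IsStarPath M ((p.concat hbc).concat hcv) := by
  obtain ⟨hpath, heven, ha, halt⟩ := hp
  refine ⟨(hpath.concat hc hbc).concat ?_ hcv, ?_, ha, (halt.concat hbc ?_).concat hcv ?_⟩
  · simpa [Walk.support_concat, hv] using hcv.ne'
  · simp only [Walk.length_concat]
    grind
  · simpa [hbcM] using heven
  · simpa [hcvM, Walk.length_concat] using heven.add_one

/-- A vertex missed by some maximum matching `N` is reached by a star path relative to `M` that
avoids all common edges of `M` and `N`. -/
theorem exists_isStarPath_of_not_mSaturates [Finite V] (hM : IsMatchingSet G M)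
    (hN : IsMatchingSet G N) (hcard : N.ncard = nu G) {v : V} (hv : ¬ MSaturates N v) :
    ∃ (a : V) (p : G.Walk a v), IsStarPath M p ∧ ∀ w ∈ p.support, ∀ e ∈ M ∩ N, w ∉ e := by
  induction hn : (M \ N).ncard using Nat.strong_induction_on generalizing N v with
  | _ n ih =>
  by_cases hvM : MSaturates M v
  swap
  · refine ⟨v, .nil, ⟨.nil, by simp, hvM, fun i h => by simp at h⟩, ?_⟩
    simp only [Walk.support_nil, List.mem_singleton, forall_eq]
    exact fun e he hve => hvM ⟨e, he.1, hve⟩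
  obtain ⟨e, heM, hve⟩ := hvM
  obtain ⟨x, rfl⟩ := Sym2.mem_iff_exists.mp hve
  have hvx : G.Adj v x := hM.1 heM
  have hvxN : s(v, x) ∉ N := fun h => hv ⟨_, h, hve⟩
  have hx : MSaturates N x := by
    by_contra hx
    have h := (hN.insert (e := s(v, x)) hvx (by
      intro w hw
      rcases Sym2.mem_iff.mp hw with rfl | rfl <;> assumption)).ncard_le_nu
    rw [Set.ncard_insert_of_notMem hvxN] at h
    omega
  obtain ⟨f, hfN, hxf⟩ := hx
  obtain ⟨y, rfl⟩ := Sym2.mem_iff_exists.mp hxf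
  have hxy : G.Adj x y := hN.1 hfN
  have hfM : s(x, y) ∉ M := by
    intro h
    have := hM.eq_of_mem heM h (Sym2.mem_mk_right v x) (Sym2.mem_mk_left x y)
    exact hvxN (this ▸ hfN)
  have hyv : y ≠ v := by
    rintro rfl
    exact hv ⟨_, hfN, Sym2.mem_mk_right _ _⟩
  set N' : Set (Sym2 V) := insert s(v, x) (N \ {s(x, y)}) with hN'
  have hN'm : IsMatchingSet G N' := by
    refine (hN.subset Set.sdiff_subset).insert hvx ?_
    rintro w hw ⟨g, hg, hwg⟩
    rcases Sym2.mem_iff.mp hw with rfl | rfl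
    · exact hv ⟨g, hg.1, hwg⟩
    · exact hg.2 (hN.eq_of_mem hg.1 hfN hwg hxf)
  have hN'c : N'.ncard = nu G := by
    rw [hN', Set.ncard_insert_of_notMem (fun h => hvxN h.1),
      Set.ncard_sdiff_singleton_add_one hfN, hcard]
  have hy : ¬ MSaturates N' y := by
    rintro ⟨g, rfl | hg, hyg⟩
    · rcases Sym2.mem_iff.mp hyg with h | h
      · exact hyv h
      · exact hxy.ne h.symm
    · exact hg.2 (hN.eq_of_mem hg.1 hfN hyg (Sym2.mem_mk_right _ _))
  have hlt : (M \ N').ncard < n := by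
    rw [← hn]
    refine Set.ncard_lt_ncard ⟨?_, fun h => (h ⟨heM, hvxN⟩).2 (Set.mem_insert _ _)⟩
      (Set.toFinite _)
    rintro g ⟨hgM, hgN'⟩
    refine ⟨hgM, fun hgN => hgN' (Or.inr ⟨hgN, ?_⟩)⟩
    rintro rfl
    exact hfM hgM
  obtain ⟨a, p, hp, hdisj⟩ := ih _ hlt hN'm hN'c hy rfl
  have hvx_mem : s(v, x) ∈ M ∩ N' := ⟨heM, Set.mem_insert _ _⟩
  refine ⟨a, (p.concat hxy.symm).concat hvx.symm,
    hp.concat_concat _ _ (by rwa [Sym2.eq_swap]) (by rwa [Sym2.eq_swap])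
      (fun h => hdisj x h _ hvx_mem (Sym2.mem_mk_right _ _))
      (fun h => hdisj v h _ hvx_mem hve), ?_⟩
  rintro w hw g ⟨hgM, hgN⟩ hwg
  simp only [Walk.support_concat, List.mem_append,
    List.mem_singleton] at hw
  rcases hw with (hw | rfl) | rfl
  · refine hdisj w hw g ⟨hgM, Or.inr ⟨hgN, ?_⟩⟩ hwg
    rintro rfl
    exact hfM hgM
  · exact hvxN (hM.eq_of_mem hgM heM hwg (Sym2.mem_mk_right _ _) ▸ hgN)
  · exact hv ⟨g, hgN, hwg⟩

/-- If adding an edge increases the matching number, then its endpoints are star vertices relative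
to every matching. -/
theorem isStarVertex_of_nu_lt_nu_sup_edge [Finite V] (hM : IsMatchingSet G M) {u v : V}
    (h : nu G < nu (G ⊔ edge v u)) : IsStarVertex G M v := by
  obtain ⟨N, hN, hcard⟩ := exists_isMatchingSet_ncard_eq_nu (G ⊔ edge v u)
  have hedge : ∀ e ∈ N, e ≠ s(v, u) → e ∈ G.edgeSet := by
    intro e he hne
    have := hN.1 he
    rw [edgeSet_sup] at this
    exact this.resolve_right fun h' => hne (edgeSet_edge_subset h')
  have huvN : s(v, u) ∈ N := by
    by_contra hnot
    have : IsMatchingSet G N :=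
      ⟨fun e he => hedge e he (fun h' => hnot (h' ▸ he)), hN.2⟩
    have := this.ncard_le_nu
    omega
  have hN' : IsMatchingSet G (N \ {s(v, u)}) :=
    ⟨fun e he => hedge e he.1 he.2, hN.2.mono Set.sdiff_subset⟩
  have hcard' := Set.ncard_sdiff_singleton_add_one huvN
  have hle := hN'.ncard_le_nu
  obtain ⟨a, p, hp, -⟩ := exists_isStarPath_of_not_mSaturates hM hN' (by omega) (v := v) (by
    rintro ⟨e, he, hve⟩
    exact he.2 (hN.eq_of_mem he.1 huvN hve (Sym2.mem_mk_left _ _)))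
  exact ⟨a, p, hp⟩

end Matchings

/-- in `G ∈ F(d,m)` with an isolated vertex, every non-star vertex (relative
to a maximum matching `M`) has degree exactly `d - 1`. -/
theorem stmt_3 {d m : ℕ} (hd : 2 ≤ d) (hm : 2 ≤ m) {V : Type} [Fintype V]
    (G : SimpleGraph V) (hG : MemF d m G) (M : Set (Sym2 V))
    (hM : IsMatchingSet G M) (hmax : M.ncard = nu G)
    (hiso : ∃ u : V, ∀ w : V, ¬ G.Adj u w)
    (v : V) (hv : ¬ IsStarVertex G M v) :
    (G.neighborSet v).ncard = d - 1 := by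
  obtain ⟨u, hu⟩ := hiso
  obtain ⟨hdeg, hnu, hext⟩ := hG
  by_contra hne
  have hvlt : (G.neighborSet v).ncard + 1 < d := by
    have := hdeg v
    omega
  have huv : v ≠ u := by
    rintro rfl
    refine hv ⟨v, .nil, .nil, by simp, ?_, fun i h => by simp at h⟩
    rintro ⟨e, he, hve⟩
    obtain ⟨w, rfl⟩ := Sym2.mem_iff_exists.mp hve
    exact hu w (hM.1 he)
  have hmore : G.edgeSet.ncard < (G ⊔ edge v u).edgeSet.ncard := by
    refine Set.ncard_lt_ncard (edgeSet_strict_mono ?_) (Set.toFinite _)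
    exact lt_sup_edge _ _ _ huv fun h => hu v h.symm
  rcases hext V (.refl V) (G ⊔ edge v u) (fun _ _ h => Or.inl h) hmore with ⟨w, hw⟩ | hge
  · by_cases hwv : w = v
    · subst hwv
      have : (G ⊔ edge w u).neighborSet w ⊆ insert u (G.neighborSet w) := by
        intro z hz
        simp only [mem_neighborSet, sup_adj, edge_adj, Set.mem_insert_iff] at hz ⊢
        grind
      have := Set.ncard_le_ncard this (Set.toFinite _)
      have := Set.ncard_insert_le u (G.neighborSet w)
      omega
    by_cases hwu : w = u
    · subst hwu
      have : (G ⊔ edge v w).neighborSet w ⊆ {v} := by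
        intro z hz
        have := hu z
        simp only [mem_neighborSet, sup_adj, edge_adj, Set.mem_singleton_iff] at hz ⊢
        grind
      have := Set.ncard_le_ncard this (Set.toFinite _)
      rw [Set.ncard_singleton] at this
      omega
    · have : (G ⊔ edge v u).neighborSet w ⊆ G.neighborSet w := by
        intro z hz
        simp only [mem_neighborSet, sup_adj, edge_adj] at hz ⊢
        grind
      have := Set.ncard_le_ncard this (Set.toFinite _)
      have := hdeg w
      omega
  · exact hv (isStarVertex_of_nu_lt_nu_sup_edge hM (hnu.trans_le hge))
end

section
/- Let G be a finite simple graph with a matching M, and let P1 = (x_1, x_2, ..., x_n) and P2 = (y_1, y_2, ..., y_m) be star paths of G relative to M. If P1 and P2 share at least one vertex, then either there exists a star path relative to M from x_1 to y_m, or there exists an M-augmenting path from x_1 to y_1. -/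
open SimpleGraph

/-- A walk meeting a set `S` splits at its first vertex in `S`. -/
lemma SimpleGraph.Walk.exists_eq_append_first_mem {V : Type} {G : SimpleGraph V} {a b : V}
    (p : G.Walk a b) (S : Set V) (h : ∃ w ∈ p.support, w ∈ S) :
    ∃ w ∈ S, ∃ (q : G.Walk a w) (r : G.Walk w b), p = q.append r ∧
      ∀ v ∈ q.support, v ∈ S → v = w := by
  induction p with
  | @nil u =>
    obtain ⟨w, hw, hS⟩ := h
    obtain rfl : w = u := by simpa using hw
    exact ⟨w, hS, .nil, .nil, rfl, by simp⟩
  | @cons u v b huv p ih =>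
    by_cases hu : u ∈ S
    · exact ⟨u, hu, .nil, .cons huv p, rfl, by simp⟩
    · obtain ⟨w, hw, hS⟩ := h
      have hwp : w ∈ p.support := by
        rcases List.mem_cons.1 (Walk.support_cons huv p ▸ hw) with rfl | h
        · exact absurd hS hu
        · exact h
      obtain ⟨x, hx, q, r, rfl, hq⟩ := ih ⟨w, hwp, hS⟩
      refine ⟨x, hx, .cons huv q, r, rfl, fun y hy hyS => ?_⟩
      rcases List.mem_cons.1 (Walk.support_cons huv q ▸ hy) with rfl | h
      · exact absurd hyS hu
      · exact hq y h hyS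

lemma SimpleGraph.Walk.IsPath.append_of_inter {V : Type} {G : SimpleGraph V} {a w b : V}
    {p : G.Walk a w} {q : G.Walk w b} (hp : p.IsPath) (hq : q.IsPath)
    (h : ∀ v ∈ p.support, v ∈ q.support → v = w) : (p.append q).IsPath := by
  induction p with
  | nil => simpa using hq
  | cons huv p ih =>
    rw [Walk.cons_isPath_iff] at hp
    rw [Walk.cons_append, Walk.cons_isPath_iff]
    refine ⟨ih hp.1 hq fun v hv => h v (by simp [hv]), fun hu => ?_⟩
    rcases (Walk.mem_support_append_iff _ _).1 hu with hu | hu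
    · exact hp.2 hu
    · exact hp.2 (h _ (by simp) hu ▸ p.end_mem_support)

lemma isAlternating_iff_getVert {V : Type} {M : Set (Sym2 V)} {G : SimpleGraph V} {a b : V}
    {p : G.Walk a b} :
    IsAlternating M p ↔ ∀ i < p.length, (s(p.getVert i, p.getVert (i + 1)) ∈ M ↔ Odd i) := by
  simp only [_root_.IsAlternating, Walk.getElem_edges, Walk.length_edges]

lemma isAlternating_append {V : Type} {M : Set (Sym2 V)} {G : SimpleGraph V} {a w b : V}
    {p : G.Walk a w} {q : G.Walk w b} :
    IsAlternating M (p.append q) ↔ IsAlternating M p ∧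
      ∀ i < q.length, (s(q.getVert i, q.getVert (i + 1)) ∈ M ↔ Odd (p.length + i)) := by
  simp only [isAlternating_iff_getVert, Walk.length_append]
  refine ⟨fun h => ⟨fun i hi => ?_, fun i hi => ?_⟩, fun h i hi => ?_⟩
  · simpa [Walk.getVert_append', hi.le, Nat.succ_le_of_lt hi] using h i (by omega)
  · simpa [Walk.getVert_append, add_assoc] using h (p.length + i) (by omega)
  · by_cases hip : i < p.length
    · simpa [Walk.getVert_append', hip.le, Nat.succ_le_of_lt hip] using h.1 i hip
    · obtain ⟨k, rfl⟩ := Nat.exists_eq_add_of_le (not_lt.1 hip)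
      simpa [Walk.getVert_append, add_assoc] using h.2 k (by omega)

/-- The last edge of a nonempty alternating walk of even length lies in `M`. -/
lemma IsAlternating.penultimate_mem {V : Type} {M : Set (Sym2 V)} {G : SimpleGraph V} {a b : V}
    {p : G.Walk a b} (h : IsAlternating M p) (he : Even p.length) (h0 : p.length ≠ 0) :
    s(p.penultimate, b) ∈ M := by
  have hlast := (isAlternating_iff_getVert.1 h (p.length - 1) (by omega)).2
    (Nat.Even.sub_odd (by omega) he odd_one)
  rwa [Nat.sub_add_cancel (by omega), Walk.getVert_length] at hlast

lemma IsMatchingSet.eq_of_mem_s4 {V : Type} {G : SimpleGraph V} {M : Set (Sym2 V)}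
    (hM : IsMatchingSet G M) {u v w : V} (hu : s(u, w) ∈ M) (hv : s(v, w) ∈ M) : u = v := by
  by_contra hne
  refine hM.2 hu hv (fun h => hne ?_) w (by simp) (by simp)
  exact Sym2.congr_left.1 h

/-- A vertex at which an even-length alternating walk is split is either its initial vertex or
matched along the walk. -/
lemma IsAlternating.exists_mem_support {V : Type} {M : Set (Sym2 V)} {G : SimpleGraph V}
    {a w b : V} {p : G.Walk a w} {q : G.Walk w b} (h : IsAlternating M (p.append q))
    (he : Even (p.append q).length) (h0 : p.length ≠ 0) :
    ∃ z ∈ (p.append q).support, s(z, w) ∈ M := by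
  rw [isAlternating_append] at h
  rw [Walk.length_append] at he
  rcases Nat.even_or_odd p.length with hp | hp
  · exact ⟨p.penultimate, (Walk.mem_support_append_iff _ _).2
      (.inl (p.getVert_mem_support _)), h.1.penultimate_mem hp h0⟩
  · have hq : 0 < q.length := by
      by_contra hq
      rw [Nat.eq_zero_of_not_pos hq, add_zero] at he
      exact (Nat.not_even_iff_odd.2 hp) he
    refine ⟨q.getVert 1, (Walk.mem_support_append_iff _ _).2
      (.inr (q.getVert_mem_support _)), ?_⟩
    rw [Sym2.eq_swap]
    simpa using (h.2 0 hq).2 (by simpa using hp)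

/-- if two star paths share a vertex, then either there is a star path from
the start of the first to the end of the second, or an `M`-augmenting path between their
starting vertices. -/
theorem stmt_4 {V : Type} [Fintype V] (G : SimpleGraph V) (M : Set (Sym2 V))
    (hM : IsMatchingSet G M) {a₁ b₁ a₂ b₂ : V}
    (p₁ : G.Walk a₁ b₁) (p₂ : G.Walk a₂ b₂)
    (h₁ : IsStarPath M p₁) (h₂ : IsStarPath M p₂)
    (hshare : ∃ w : V, w ∈ p₁.support ∧ w ∈ p₂.support) :
    (∃ q : G.Walk a₁ b₂, IsStarPath M q) ∨ (∃ q : G.Walk a₁ a₂, IsAugPath M q) := by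
  obtain ⟨hp₁, he₁, ha₁, alt₁⟩ := h₁
  obtain ⟨hp₂, he₂, ha₂, alt₂⟩ := h₂
  obtain ⟨w, hw₂, q₁, r₁, rfl, hfirst⟩ :=
    p₁.exists_eq_append_first_mem {v | v ∈ p₂.support} hshare
  obtain ⟨q₂, r₂, rfl⟩ := Walk.mem_support_iff_exists_append.1 hw₂
  have hpq₁ := hp₁.of_append_left
  have altq₁ := (isAlternating_append.1 alt₁).1
  have altq₂ := (isAlternating_append.1 alt₂).1
  have altr₂ := (isAlternating_append.1 alt₂).2
  have heven : Even q₁.length → q₂.length = 0 ∧ q₁.length = 0 := by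
    intro he
    have h0 : q₁.length = 0 := by
      by_contra h0
      have hx := altq₁.penultimate_mem he h0
      by_cases hq₂ : q₂.length = 0
      · obtain rfl := Walk.eq_of_length_eq_zero hq₂
        exact ha₂ ⟨_, hx, by simp⟩
      · obtain ⟨z, hz, hzM⟩ := alt₂.exists_mem_support he₂ hq₂
        have hxw := hfirst q₁.penultimate (q₁.getVert_mem_support _)
          (hM.eq_of_mem_s4 hzM hx ▸ hz)
        exact (G.ne_of_adj (hM.1 hx)) hxw
    refine ⟨?_, h0⟩
    by_contra hq₂
    obtain ⟨z, -, hzM⟩ := alt₂.exists_mem_support he₂ hq₂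
    obtain rfl := Walk.eq_of_length_eq_zero h0
    exact ha₁ ⟨_, hzM, by simp⟩
  by_cases hpar : Even q₁.length ↔ Even q₂.length
  · left
    refine ⟨q₁.append r₂, hpq₁.append_of_inter hp₂.of_append_right fun v hv hv' =>
      hfirst v hv ((Walk.mem_support_append_iff _ _).2 (.inr hv')), ?_, ha₁,
      isAlternating_append.2 ⟨altq₁, fun i hi => ?_⟩⟩
    · rw [Walk.length_append] at he₂ ⊢
      grind
    · rw [altr₂ i hi]
      grind
  · right
    have hodd : Odd q₁.length ∧ Even q₂.length := by grind
    refine ⟨q₁.append q₂.reverse, hpq₁.append_of_inter hp₂.of_append_left.reverse fun v hv hv' =>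
      hfirst v hv ((Walk.mem_support_append_iff _ _).2 (.inl (by simpa using hv'))), ?_, ha₁, ha₂,
      isAlternating_append.2 ⟨altq₁, fun i hi => ?_⟩⟩
    · rw [Walk.length_append, Walk.length_reverse]
      exact hodd.1.add_even hodd.2
    · rw [Walk.length_reverse] at hi
      have h := isAlternating_iff_getVert.1 altq₂ (q₂.length - (i + 1)) (by omega)
      rw [show q₂.length - (i + 1) + 1 = q₂.length - i by omega] at h
      rw [Walk.getVert_reverse, Walk.getVert_reverse, Sym2.eq_swap, h]
      grind
end

section
/- For all integers d, m ≥ 2, there exists a finite simple graph G with maximum degree Δ(G) < d and matching number ν(G) < m such that |E(G)| = (d-1)(m-1) + ⌊(m-1)/⌈(d-1)/2⌉⌋ · ⌊(d-1)/2⌋; that is, the bound e(d,m) = (d-1)(m-1) + ⌊(m-1)/⌈(d-1)/2⌉⌋ · ⌊(d-1)/2⌋ is attained. -/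
open SimpleGraph

/-- Some finite graph with exactly `E` edges has maximum degree at most `D` and all matchings of
size at most `M`. -/
def IsAttained (D M E : ℕ) : Prop :=
  ∃ (V : Type) (_ : Fintype V) (G : SimpleGraph V),
    (∀ v : V, (G.neighborSet v).ncard ≤ D) ∧
    (∀ S : Set (Sym2 V), IsMatchingSet G S → S.ncard ≤ M) ∧ G.edgeSet.ncard = E

theorem nu_le {V : Type} {G : SimpleGraph V} {M : ℕ}
    (h : ∀ S : Set (Sym2 V), IsMatchingSet G S → S.ncard ≤ M) : nu G ≤ M := by
  refine csSup_le ⟨0, ∅, ⟨Set.empty_subset _, Set.pairwise_empty _⟩, Set.ncard_empty _⟩ ?_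
  rintro n ⟨S, hS, rfl⟩
  exact h S hS

theorem IsMatchingSet.preimage_map {V W : Type} {G : SimpleGraph V} {H : SimpleGraph W}
    {S : Set (Sym2 W)} (hS : IsMatchingSet H S) (f : G ↪g H) :
    IsMatchingSet G (Sym2.map f ⁻¹' S) := by
  refine ⟨fun e he => ?_, fun e he e' he' hne v hv hv' => ?_⟩
  · exact (SimpleGraph.Embedding.map_mem_edgeSet_iff f).1 (hS.1 he)
  · exact hS.2 he he' ((Sym2.map.injective f.injective).ne hne) (f v)
      (Sym2.mem_map.2 ⟨v, hv, rfl⟩) (Sym2.mem_map.2 ⟨v, hv', rfl⟩)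

/-- A matching has at most half as many edges as there are vertices. -/
theorem IsMatchingSet.two_mul_ncard_le {V : Type} [Fintype V] {G : SimpleGraph V}
    {S : Set (Sym2 V)} (hS : IsMatchingSet G S) : 2 * S.ncard ≤ Fintype.card V := by
  classical
  rw [Set.ncard_eq_toFinset_card' S]
  have hdisj : ((S.toFinset : Finset (Sym2 V)) : Set (Sym2 V)).PairwiseDisjoint
      Sym2.toFinset := by
    intro e he e' he' hne
    rw [Function.onFun, Finset.disjoint_left]
    intro v hv hv'
    exact hS.2 (by simpa using he) (by simpa using he') hne v (Sym2.mem_toFinset.1 hv)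
      (Sym2.mem_toFinset.1 hv')
  have hcard : ∀ e ∈ S.toFinset, e.toFinset.card = 2 := fun e he =>
    Sym2.card_toFinset_of_not_isDiag e
      (G.not_isDiag_of_mem_edgeSet (hS.1 (Set.mem_toFinset.1 he)))
  rw [mul_comm, ← Finset.sum_const_nat hcard, ← Finset.card_biUnion hdisj]
  exact Finset.card_le_univ _

theorem isAttained_zero (D : ℕ) : IsAttained D 0 0 :=
  ⟨Empty, inferInstance, ⊥, fun v => v.elim, fun S _ => by simp [Set.eq_empty_of_isEmpty S],
    by simp⟩

theorem IsAttained.add {D M E M' E' : ℕ} (h : IsAttained D M E) (h' : IsAttained D M' E') :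
    IsAttained D (M + M') (E + E') := by
  obtain ⟨V, _, G, hG, hM, rfl⟩ := h
  obtain ⟨W, _, H, hH, hM', rfl⟩ := h'
  refine ⟨V ⊕ W, inferInstance, G ⊕g H, ?_, fun S hS => ?_, ?_⟩
  · rintro (v | w)
    · have : (G ⊕g H).neighborSet (.inl v) = Sum.inl '' G.neighborSet v := by
        ext (x | x) <;> simp
      rw [this, Set.ncard_image_of_injective _ Sum.inl_injective]
      exact hG v
    · have : (G ⊕g H).neighborSet (.inr w) = Sum.inr '' H.neighborSet w := by
        ext (x | x) <;> simp
      rw [this, Set.ncard_image_of_injective _ Sum.inr_injective]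
      exact hH w
  · have hsub : S ⊆ Sym2.map Sum.inl '' (Sym2.map Sum.inl ⁻¹' S) ∪
        Sym2.map Sum.inr '' (Sym2.map Sum.inr ⁻¹' S) := by
      intro e he
      have hadj := hS.1 he
      induction e with
      | _ a b =>
        rcases a with a | a <;> rcases b with b | b
        · exact .inl ⟨s(a, b), he, rfl⟩
        · simp at hadj
        · simp at hadj
        · exact .inr ⟨s(a, b), he, rfl⟩
    calc S.ncard ≤ _ := Set.ncard_le_ncard hsub
      _ ≤ _ := Set.ncard_union_le _ _
      _ ≤ M + M' := by
        rw [Set.ncard_image_of_injective _ (Sym2.map.injective Sum.inl_injective),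
          Set.ncard_image_of_injective _ (Sym2.map.injective Sum.inr_injective)]
        exact add_le_add (hM _ (hS.preimage_map Embedding.sumInl))
          (hM' _ (hS.preimage_map Embedding.sumInr))
  · simp only [← Nat.card_coe_set_eq]
    rw [Nat.card_congr edgeSetSumEquiv, Nat.card_sum]

theorem IsAttained.mul_left {D M E : ℕ} (h : IsAttained D M E) (n : ℕ) :
    IsAttained D (n * M) (n * E) := by
  induction n with
  | zero => simpa using isAttained_zero D
  | succ n ih => simpa only [Nat.succ_mul] using ih.add h

/-- The star with `D` leaves. -/
theorem isAttained_star {D : ℕ} (hD : 1 ≤ D) : IsAttained D 1 D := by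
  refine ⟨Unit ⊕ Fin D, inferInstance, completeBipartiteGraph Unit (Fin D), fun v => ?_,
    fun S hS => ?_, ?_⟩
  · rcases v with v | i
    · have : (completeBipartiteGraph Unit (Fin D)).neighborSet (.inl v) = Set.range Sum.inr := by
        ext (x | x) <;> simp
      rw [this, Set.ncard_range_of_injective Sum.inr_injective, Nat.card_fin]
    · have : (completeBipartiteGraph Unit (Fin D)).neighborSet (.inr i) = {.inl ()} := by
        ext (x | x) <;> simp
      rwa [this, Set.ncard_singleton]
  · have hmem : ∀ e ∈ (completeBipartiteGraph Unit (Fin D)).edgeSet, .inl () ∈ e := by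
      rw [edgeSet_completeBipartiteGraph]
      rintro _ ⟨⟨⟨⟩, i⟩, rfl⟩
      simp
    rw [Set.ncard_le_one_iff]
    intro e e' he he'
    by_contra hne
    exact hS.2 he he' hne (.inl ()) (hmem e (hS.1 he)) (hmem e' (hS.1 he'))
  · simp [Set.ncard, encard_edgeSet_completeBipartiteGraph]

/-- The complete graph on `2 * k + 1` vertices. -/
theorem isAttained_completeGraph (k : ℕ) : IsAttained (2 * k) k (2 * k * k + k) := by
  refine ⟨Fin (2 * k + 1), inferInstance, ⊤, fun v => ?_, fun S hS => ?_, ?_⟩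
  · simp [Set.ncard_eq_toFinset_card', Finset.card_compl]
  · have := hS.two_mul_ncard_le
    rw [Fintype.card_fin] at this
    omega
  · rw [← coe_edgeFinset, Set.ncard_coe_finset, card_edgeFinset_top_eq_card_choose_two,
      Fintype.card_fin, Nat.choose_two_right]
    apply Nat.div_eq_of_eq_mul_left two_pos
    rw [Nat.add_sub_cancel]
    ring

/-- The complete graph on `2 * k + 3` vertices minus a spanning forest made of one path with two
edges and `k` disjoint edges. -/
theorem isAttained_completeGraph_deleteEdges (k : ℕ) :
    IsAttained (2 * k + 1) (k + 1) ((2 * k + 1) * (k + 1) + k) := by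
  let f : Option (Fin (k + 1)) → Sym2 (Option (Fin (k + 1) × Bool))
    | none => s(none, some (0, false))
    | some i => s(some (i, false), some (i, true))
  have hf : f.Injective := by
    rintro (_ | i) (_ | j) h <;> simp_all [f]
  have hcover : ∀ v : Option (Fin (k + 1) × Bool), ∃ w, w ≠ v ∧ s(v, w) ∈ Set.range f := by
    rintro (_ | ⟨i, _ | _⟩)
    · exact ⟨some (0, false), by simp, none, rfl⟩
    · exact ⟨some (i, true), by simp, some i, rfl⟩
    · exact ⟨some (i, false), by simp, some i, Sym2.eq_swap⟩
  have hsub : Set.range f ⊆ (⊤ : SimpleGraph (Option (Fin (k + 1) × Bool))).edgeSet := by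
    rintro _ ⟨_ | i, rfl⟩ <;> simp [f]
  have hcard : Fintype.card (Option (Fin (k + 1) × Bool)) = 2 * k + 3 := by
    simp; ring
  refine ⟨_, inferInstance, (⊤ : SimpleGraph (Option (Fin (k + 1) × Bool))).deleteEdges
    (Set.range f), fun v => ?_, fun S hS => ?_, ?_⟩
  · obtain ⟨w, hwv, hw⟩ := hcover v
    have hle : ((⊤ : SimpleGraph (Option (Fin (k + 1) × Bool))).deleteEdges
        (Set.range f)).neighborSet v ⊆ ({v, w} : Set _)ᶜ := by
      rintro x hx (rfl | rfl)
      · exact SimpleGraph.irrefl _ ((mem_neighborSet ..).1 hx)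
      · rw [mem_neighborSet, deleteEdges_adj] at hx
        exact hx.2 hw
    refine (Set.ncard_le_ncard hle).trans ?_
    rw [Set.ncard_compl, Set.ncard_pair hwv.symm, Nat.card_eq_fintype_card, hcard]
    omega
  · have := hS.two_mul_ncard_le
    rw [hcard] at this
    omega
  · rw [edgeSet_deleteEdges, Set.ncard_sdiff hsub, Set.ncard_range_of_injective hf,
      ← coe_edgeFinset, Set.ncard_coe_finset, card_edgeFinset_top_eq_card_choose_two, hcard,
      Nat.card_eq_fintype_card, Fintype.card_option, Fintype.card_fin]
    have : (2 * k + 3).choose 2 = (2 * k + 3) * (k + 1) := by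
      rw [Nat.choose_two_right]
      apply Nat.div_eq_of_eq_mul_left two_pos
      rw [show 2 * k + 3 - 1 = 2 * (k + 1) by omega]
      ring
    rw [this]
    apply Nat.sub_eq_of_eq_add
    ring

/-- The dense block with matching number `⌈D / 2⌉`. -/
theorem isAttained_block {D : ℕ} (hD : 1 ≤ D) :
    IsAttained D ((D + 1) / 2) (D * ((D + 1) / 2) + D / 2) := by
  obtain ⟨k, rfl | rfl⟩ := Nat.even_or_odd' D
  · rw [show (2 * k + 1) / 2 = k by omega, show 2 * k / 2 = k by omega]
    exact isAttained_completeGraph k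
  · rw [show (2 * k + 1 + 1) / 2 = k + 1 by omega, show (2 * k + 1) / 2 = k by omega]
    exact isAttained_completeGraph_deleteEdges k

/-- the bound `(d-1)(m-1) + ⌊(m-1)/⌈(d-1)/2⌉⌋·⌊(d-1)/2⌋` is attained by some
finite simple graph with `Δ < d` and `ν < m`. -/
theorem stmt_11 {d m : ℕ} (hd : 2 ≤ d) (hm : 2 ≤ m) :
    ∃ (V : Type) (_ : Fintype V) (G : SimpleGraph V),
      (∀ v : V, (G.neighborSet v).ncard < d) ∧ nu G < m ∧
      G.edgeSet.ncard =
        (d - 1) * (m - 1) + (m - 1) / (((d - 1) + 1) / 2) * ((d - 1) / 2) := by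
  have hD : 1 ≤ d - 1 := by omega
  obtain ⟨V, hV, G, hdeg, hmatch, hedge⟩ :=
    ((isAttained_block hD).mul_left ((m - 1) / ((d - 1 + 1) / 2))).add
      ((isAttained_star hD).mul_left ((m - 1) % ((d - 1 + 1) / 2)))
  have hdiv := Nat.div_add_mod (m - 1) ((d - 1 + 1) / 2)
  refine ⟨V, hV, G, fun v => ?_, ?_, ?_⟩
  · have := hdeg v
    omega
  · have := nu_le hmatch
    rw [mul_one, mul_comm, hdiv] at this
    omega
  · rw [hedge]
    generalize (m - 1) / ((d - 1 + 1) / 2) = q at *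
    generalize (m - 1) % ((d - 1 + 1) / 2) = r at *
    rw [← hdiv]
    ring
end
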